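/- arXiv:1611.02425 — 7 statements merged into one kernel-verified Lean document; each statement's English description precedes it below -/
import Mathlib

section
/- Let N ≥ 1 and k ≥ 1 be integers and let f_1, …, f_k be real-valued functions on {1, …, N}. Let P be the N×N lower-triangular all-ones matrix (P_{i,j} = 1 if i ≥ j, else 0), and for each l let S_{f_l} be the index matrix of f_l. Then for all 1 ≤ j ≤ i ≤ N, the entry (P · S_{f_1} · S_{f_2} ⋯ S_{f_k})_{i,j} equals the multiplicative nested sum S(f_1, …, f_k; i, j) = ∑_{i ≥ n_1 ≥ n_2 ≥ ⋯ ≥ n_k ≥ j} f_1(n_1)···f_k(n_k). -/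
open Finset Matrix

/-- The multiplicative nested sum `S(f₁,…,f_k; N, m) = ∑_{N ≥ n₁ ≥ ⋯ ≥ n_k ≥ m} f₁(n₁)⋯f_k(n_k)`,
defined recursively on the list of summand functions. -/
noncomputable def nestedS : List (ℕ → ℝ) → ℕ → ℕ → ℝ
  | [], _, _ => 1
  | f :: fs, N, m => ∑ n ∈ Finset.Icc m N, f n * nestedS fs n m

/-- The `N × N` index matrix of `f`: entry `(i,j)` (1-based) is `f(i)` if `i ≥ j`, else `0`.
Here rows/columns are indexed by `Fin N`, with `i : Fin N` corresponding to `i + 1` (1-based). -/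
noncomputable def idxS (N : ℕ) (f : ℕ → ℝ) : Matrix (Fin N) (Fin N) ℝ :=
  Matrix.of fun i j => if (j : ℕ) ≤ (i : ℕ) then f ((i : ℕ) + 1) else 0

/-- The `N × N` lower-triangular all-ones matrix. -/
noncomputable def lowP (N : ℕ) : Matrix (Fin N) (Fin N) ℝ :=
  Matrix.of fun i j => if (j : ℕ) ≤ (i : ℕ) then (1 : ℝ) else 0

theorem idxS_eq_diagonal_mul_lowP (N : ℕ) (f : ℕ → ℝ) :
    idxS N f = diagonal (fun i : Fin N => f ((i : ℕ) + 1)) * lowP N := by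
  ext i j
  simp [idxS, lowP, diagonal_mul]

/-- Summing over row indices between `j` and `i` is summing over the 1-based interval. -/
theorem sum_fin_ite_eq_sum_Icc (N : ℕ) (i j : Fin N) (g : ℕ → ℝ) :
    (∑ n : Fin N, if (j : ℕ) ≤ n ∧ (n : ℕ) ≤ i then g ((n : ℕ) + 1) else 0)
      = ∑ n ∈ Finset.Icc ((j : ℕ) + 1) ((i : ℕ) + 1), g n := by
  rw [Fin.sum_univ_eq_sum_range
    (fun n => if (j : ℕ) ≤ n ∧ n ≤ (i : ℕ) then g (n + 1) else 0) N,
    ← Finset.sum_filter]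
  refine Finset.sum_bij (fun n _ => n + 1) ?_ ?_ ?_ ?_
  · simp only [mem_filter, mem_range, mem_Icc]
    omega
  · intros
    omega
  · intro b hb
    have hi := i.isLt
    simp only [mem_Icc] at hb
    exact ⟨b - 1, by simp only [mem_filter, mem_range]; omega, by omega⟩
  · intros
    rfl

theorem lowP_mul_prod_idxS_apply (N : ℕ) (fs : List (ℕ → ℝ)) (i j : Fin N) :
    (lowP N * (fs.map (idxS N)).prod) i j
      = if (j : ℕ) ≤ i then nestedS fs ((i : ℕ) + 1) ((j : ℕ) + 1) else 0 := by
  induction fs generalizing i with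
  | nil => simp [lowP, nestedS]
  | cons f fs ih =>
    have hsum : (lowP N * ((f :: fs).map (idxS N)).prod) i j
        = ∑ n : Fin N, if (j : ℕ) ≤ n ∧ (n : ℕ) ≤ i then
            f ((n : ℕ) + 1) * nestedS fs ((n : ℕ) + 1) ((j : ℕ) + 1) else 0 := by
      rw [List.map_cons, List.prod_cons, idxS_eq_diagonal_mul_lowP, Matrix.mul_assoc, mul_apply]
      refine Finset.sum_congr rfl fun n _ => ?_
      rw [diagonal_mul, ih]
      simp only [lowP, of_apply]
      split_ifs <;> first | omega | simp
    rw [hsum, sum_fin_ite_eq_sum_Icc N i j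
      (fun n => f n * nestedS fs n ((j : ℕ) + 1))]
    split_ifs with h
    · rfl
    · rw [Finset.Icc_eq_empty (by omega), Finset.sum_empty]

theorem stmt_0 (N k : ℕ) (hN : 1 ≤ N) (hk : 1 ≤ k)
    (fs : List (ℕ → ℝ)) (hfs : fs.length = k)
    (i j : Fin N) (hji : j ≤ i) :
    (lowP N * (fs.map (idxS N)).prod) i j
      = nestedS fs ((i : ℕ) + 1) ((j : ℕ) + 1) := by
  rw [lowP_mul_prod_idxS_apply, if_pos (Fin.le_def.mp hji)]
end

section
/- Let N ≥ 1 and k ≥ 1 be integers and let f_1, …, f_k be real-valued functions on {1, …, N}. Let P be the N×N lower-triangular all-ones matrix (P_{i,j} = 1 if i ≥ j, else 0), and for each l let A_{f_l} be the strict index matrix of f_l. Then for all integers 1 ≤ m ≤ N, the entry (P · A_{f_1} · A_{f_2} ⋯ A_{f_k})_{N,m} equals the strict multiplicative nested sum A(f_1, …, f_k; N, m) = ∑_{N > n_1 > n_2 > ⋯ > n_k ≥ m} f_1(n_1)···f_k(n_k). -/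
open Finset Matrix

/-- The strict multiplicative nested sum
`A(f₁,…,f_k; N, m) = ∑_{N > n₁ > ⋯ > n_k ≥ m} f₁(n₁)⋯f_k(n_k)`. -/
noncomputable def nestedA : List (ℕ → ℝ) → ℕ → ℕ → ℝ
  | [], _, _ => 1
  | f :: fs, N, m => ∑ n ∈ Finset.Ico m N, f n * nestedA fs n m

/-- The `N × N` strict index matrix of `f`: entry `(i,j)` (1-based) is `f(i-1)` if `i - 1 ≥ j`,
else `0`. Here `i : Fin N` corresponds to the 1-based index `i + 1`. -/
noncomputable def idxA (N : ℕ) (f : ℕ → ℝ) : Matrix (Fin N) (Fin N) ℝ :=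
  Matrix.of fun i j => if (j : ℕ) < (i : ℕ) then f (i : ℕ) else 0

/-- Partial column sums of a product of strict index matrices are strict nested sums. -/
theorem sum_prod_idxA_eq_nestedA (N : ℕ) (fs : List (ℕ → ℝ)) (m : Fin N) (n : ℕ) (hn : n ≤ N) :
    (∑ a : Fin N, if (a : ℕ) < n then (fs.map (idxA N)).prod a m else 0)
      = if (m : ℕ) < n then nestedA fs n ((m : ℕ) + 1) else 0 := by
  induction fs generalizing n with
  | nil =>
    rw [Finset.sum_eq_single m]
    · simp [nestedA]
    · intro b _ hb
      simp [Matrix.one_apply_ne hb]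
    · simp
  | cons f fs ih =>
    have row (a : Fin N) : ((f :: fs).map (idxA N)).prod a m
        = f a * if (m : ℕ) < a then nestedA fs a ((m : ℕ) + 1) else 0 := by
      rw [← ih a a.isLt.le, List.map_cons, List.prod_cons, Matrix.mul_apply, Finset.mul_sum]
      refine Finset.sum_congr rfl fun b _ => ?_
      simp [idxA]
    simp only [row]
    rw [Fin.sum_univ_eq_sum_range (fun a => if a < n then
      f a * (if (m : ℕ) < a then nestedA fs a ((m : ℕ) + 1) else 0) else 0) N]
    have nested : (if (m : ℕ) < n then nestedA (f :: fs) n ((m : ℕ) + 1) else 0)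
        = ∑ a ∈ Finset.Ico ((m : ℕ) + 1) n, f a * nestedA fs a ((m : ℕ) + 1) := by
      split_ifs with h
      · rfl
      · rw [Finset.Ico_eq_empty_of_le (by omega), Finset.sum_empty]
    rw [nested]
    symm
    apply Finset.sum_subset_zero_on_sdiff
    · intro a ha
      simp only [Finset.mem_Ico, Finset.mem_range] at *
      omega
    · intro a ha
      simp only [Finset.mem_sdiff, Finset.mem_Ico, Finset.mem_range] at ha
      split_ifs <;> first | omega | simp
    · intro a ha
      simp only [Finset.mem_Ico] at ha
      rw [if_pos ha.2, if_pos (by omega)]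

theorem stmt_1 (N k : ℕ) (hN : 1 ≤ N) (hk : 1 ≤ k)
    (fs : List (ℕ → ℝ)) (hfs : fs.length = k) (m : Fin N) :
    (lowP N * (fs.map (idxA N)).prod) ⟨N - 1, by omega⟩ m
      = nestedA fs N ((m : ℕ) + 1) := by
  have key := sum_prod_idxA_eq_nestedA N fs m N le_rfl
  rw [if_pos m.isLt] at key
  rw [← key, Matrix.mul_apply]
  refine Finset.sum_congr rfl fun a _ => ?_
  have ha : (a : ℕ) ≤ N - 1 := by omega
  rw [lowP, Matrix.of_apply, if_pos ha, if_pos a.isLt, one_mul]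
end

section
/- Let a_1, …, a_N be nonzero real numbers. For all indices 1 ≤ j ≤ i ≤ N, the identity ∑_{l=j}^{i} a_l · (a_i/a_N) · ∏_{k=l+1}^{N} (1 − a_k/a_j) = a_j · (a_i/a_N) · ∏_{k=i+1}^{N} (1 − a_k/a_j) holds (empty products are 1). -/
open Finset

/-- The telescoping sum behind the eigenvector identity. -/
theorem sum_Icc_mul_prod_one_sub_div {K : Type*} [Field K] (a : ℕ → K) {N i j : ℕ}
    (hj : a j ≠ 0) (hji : j ≤ i) (hiN : i ≤ N) :
    ∑ l ∈ Finset.Icc j i, a l * ∏ k ∈ Finset.Icc (l + 1) N, (1 - a k / a j)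
      = a j * ∏ k ∈ Finset.Icc (i + 1) N, (1 - a k / a j) := by
  induction i, hji using Nat.le_induction with
  | base => simp
  | succ i hji ih =>
    rw [Finset.sum_Icc_succ_top (by omega), ih (by omega),
      ← Finset.mul_prod_Ioc_eq_prod_Icc hiN, ← Finset.Icc_add_one_left_eq_Ioc]
    field_simp
    ring

theorem stmt_6 (N : ℕ) (a : ℕ → ℝ) (ha : ∀ n ∈ Finset.Icc 1 N, a n ≠ 0)
    (i j : ℕ) (hj : 1 ≤ j) (hji : j ≤ i) (hiN : i ≤ N) :
    ∑ l ∈ Finset.Icc j i, a l * (a i / a N) * ∏ k ∈ Finset.Icc (l + 1) N, (1 - a k / a j)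
      = a j * (a i / a N) * ∏ k ∈ Finset.Icc (i + 1) N, (1 - a k / a j) := by
  have haj : a j ≠ 0 := ha j (Finset.mem_Icc.mpr ⟨hj, hji.trans hiN⟩)
  simp only [mul_right_comm _ (a i / a N)]
  rw [← Finset.sum_mul, sum_Icc_mul_prod_one_sub_div a haj hji hiN]
end

section
/- Let a_1, …, a_N be pairwise distinct nonzero real numbers. Define N×N lower-triangular matrices D_a and E_a by d_{i,j} = (a_i/a_N) · ∏_{k=i+1}^{N} (1 − a_k/a_j) and e_{i,j} = (a_N/a_i) · ∏_{k=j, k≠i}^{N} (1 − a_k/a_i)^{-1} for i ≥ j, and d_{i,j} = e_{i,j} = 0 for i < j. Then D_a · E_a = I, i.e., E_a is the inverse of D_a. -/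
open Finset Matrix

/-- The matrix `D_a`: for 1-based indices `i ≥ j`,
`d_{i,j} = (a_i / a_N) ∏_{k=i+1}^N (1 - a_k / a_j)`, and `0` otherwise. -/
noncomputable def Dmat (N : ℕ) (a : ℕ → ℝ) : Matrix (Fin N) (Fin N) ℝ :=
  Matrix.of fun i j =>
    if (j : ℕ) ≤ (i : ℕ) then
      (a ((i : ℕ) + 1) / a N) * ∏ k ∈ Finset.Icc ((i : ℕ) + 2) N, (1 - a k / a ((j : ℕ) + 1))
    else 0

/-- The matrix `E_a`: for 1-based indices `i ≥ j`,
`e_{i,j} = (a_N / a_i) ∏_{k=j, k≠i}^N (1 - a_k / a_i)⁻¹`, and `0` otherwise. -/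
noncomputable def Emat (N : ℕ) (a : ℕ → ℝ) : Matrix (Fin N) (Fin N) ℝ :=
  Matrix.of fun i j =>
    if (j : ℕ) ≤ (i : ℕ) then
      (a N / a ((i : ℕ) + 1)) *
        ∏ k ∈ (Finset.Icc ((j : ℕ) + 1) N).erase ((i : ℕ) + 1), (1 - a k / a ((i : ℕ) + 1))⁻¹
    else 0

/-- Lagrange interpolation of the polynomial `X` at the nodes `(a m)⁻¹`, evaluated at `0`. -/
theorem sum_inv_mul_prod_one_sub_div_inv_eq_zero {ι F : Type*} [DecidableEq ι] [Field F]
    (s : Finset ι) (a : ι → F) (hinj : Set.InjOn a s) (hne : ∀ m ∈ s, a m ≠ 0)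
    (hs : 1 < s.card) :
    ∑ m ∈ s, (a m)⁻¹ * ∏ k ∈ s.erase m, (1 - a k / a m)⁻¹ = 0 := by
  have hinj' : Set.InjOn (fun m => (a m)⁻¹) (s : Set ι) :=
    fun x hx y hy h => hinj hx hy (inv_injective h)
  have hX : (Polynomial.X : Polynomial F).degree < s.card := by
    rw [Polynomial.degree_X]
    exact_mod_cast hs
  have h := congrArg (Polynomial.eval 0) (Lagrange.eq_interpolate hinj' hX)
  rw [Polynomial.eval_X, Lagrange.interpolate_apply, Polynomial.eval_finsetSum] at h
  rw [h]
  refine Finset.sum_congr rfl fun m hm => ?_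
  rw [Polynomial.eval_mul, Polynomial.eval_C, Polynomial.eval_X, Lagrange.basis,
    Polynomial.eval_prod]
  congr 1
  refine Finset.prod_congr rfl fun k hk => ?_
  obtain ⟨hkm, hk⟩ := Finset.mem_erase.mp hk
  have hm0 := hne m hm
  have hk0 := hne k hk
  have h1 : a m - a k ≠ 0 := sub_ne_zero.mpr fun e => hkm (hinj hk hm e.symm)
  have h2 : a k - a m ≠ 0 := sub_ne_zero.mpr fun e => hkm (hinj hk hm e)
  have h3 : (a m)⁻¹ - (a k)⁻¹ = (a k - a m) / (a m * a k) := by field_simp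
  have h4 : 1 - a k / a m = (a m - a k) / a m := by field_simp
  simp only [Lagrange.basisDivisor, Polynomial.eval_mul, Polynomial.eval_C, Polynomial.eval_sub,
    Polynomial.eval_X]
  rw [h3, h4]
  field_simp
  ring

/-- The factors with index above `i` cancel in the product of an entry of `Dmat` with an entry
of `Emat`. -/
theorem prod_Icc_mul_prod_erase_inv {F : Type*} [Field F] {f : ℕ → F} {i j m N : ℕ}
    (hmi : m ≤ i) (hji : j ≤ i) (hiN : i ≤ N) (hf : ∀ k ∈ Icc (i + 1) N, f k ≠ 0) :
    (∏ k ∈ Icc (i + 1) N, f k) * ∏ k ∈ (Icc j N).erase m, (f k)⁻¹ =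
      ∏ k ∈ (Icc j i).erase m, (f k)⁻¹ := by
  have hU : (Icc j N).erase m = Icc (i + 1) N ∪ (Icc j i).erase m := by
    ext k
    simp only [mem_erase, mem_Icc, mem_union]
    omega
  have hD : Disjoint (Icc (i + 1) N) ((Icc j i).erase m) := by
    rw [Finset.disjoint_left]
    intro k
    simp only [mem_erase, mem_Icc]
    omega
  rw [hU, Finset.prod_union hD, ← mul_assoc, ← Finset.prod_mul_distrib,
    Finset.prod_eq_one fun k hk => mul_inv_cancel₀ (hf k hk), one_mul]

theorem Dmat_mul_Emat_apply (N : ℕ) (a : ℕ → ℝ)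
    (hdist : Set.InjOn a (Set.Icc 1 N)) (hne : ∀ n ∈ Finset.Icc 1 N, a n ≠ 0) (i j : Fin N) :
    (Dmat N a * Emat N a) i j = a (i + 1) *
      ∑ m ∈ Icc ((j : ℕ) + 1) (i + 1),
        (a m)⁻¹ * ∏ k ∈ (Icc ((j : ℕ) + 1) (i + 1)).erase m, (1 - a k / a m)⁻¹ := by
  have hi := i.isLt
  rw [Matrix.mul_apply, Finset.mul_sum]
  symm
  refine Finset.sum_of_injOn (fun m => if h : m - 1 < N then ⟨m - 1, h⟩ else i) ?_ ?_ ?_ ?_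
  · intro x hx y hy h
    simp only [coe_Icc, Set.mem_Icc] at hx hy
    have hx' : x - 1 < N := by omega
    have hy' : y - 1 < N := by omega
    simp only [hx', hy', dif_pos, Fin.mk.injEq] at h
    omega
  · intro x _
    simp
  · intro m _ hm
    simp only [Dmat, Emat, Matrix.of_apply]
    by_cases h1 : (m : ℕ) ≤ i
    · by_cases h2 : (j : ℕ) ≤ m
      · refine absurd ⟨(m : ℕ) + 1, ?_, ?_⟩ hm
        · simp only [coe_Icc, Set.mem_Icc]
          omega
        · simp
      · rw [if_neg h2, mul_zero]
    · rw [if_neg h1, zero_mul]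
  · intro m hm
    rw [mem_Icc] at hm
    obtain ⟨m, rfl⟩ : ∃ n, m = n + 1 := ⟨m - 1, by omega⟩
    have hmN : m < N := by omega
    have hN0 : a N ≠ 0 := hne N (mem_Icc.mpr (by omega))
    have hm0 : a (m + 1) ≠ 0 := hne (m + 1) (mem_Icc.mpr (by omega))
    have hf : ∀ k ∈ Icc ((i : ℕ) + 1 + 1) N, 1 - a k / a (m + 1) ≠ 0 := by
      intro k hk h
      rw [mem_Icc] at hk
      have h' : a k = a (m + 1) := ((div_eq_one_iff_eq hm0).mp (sub_eq_zero.mp h).symm)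
      have := hdist (Set.mem_Icc.mpr (by omega)) (Set.mem_Icc.mpr (by omega)) h'
      omega
    have hmi : m ≤ i := by omega
    have hjm : (j : ℕ) ≤ m := by omega
    simp only [Dmat, Emat, Matrix.of_apply, Nat.add_sub_cancel, hmN, dif_pos, hmi, hjm, if_true]
    rw [← prod_Icc_mul_prod_erase_inv hm.2 (hm.1.trans hm.2) hi hf]
    field_simp

theorem stmt_8 (N : ℕ) (a : ℕ → ℝ)
    (hdist : Set.InjOn a (Set.Icc 1 N)) (hne : ∀ n ∈ Finset.Icc 1 N, a n ≠ 0) :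
    Dmat N a * Emat N a = 1 := by
  ext i j
  have hi := i.isLt
  rw [Dmat_mul_Emat_apply N a hdist hne]
  rcases lt_trichotomy (i : ℕ) j with hij | hij | hij
  · rw [Icc_eq_empty (by omega), sum_empty, mul_zero, Matrix.one_apply_ne (by omega)]
  · obtain rfl := Fin.ext hij
    simp [hne (i + 1) (mem_Icc.mpr (by omega))]
  · rw [sum_inv_mul_prod_one_sub_div_inv_eq_zero, mul_zero, Matrix.one_apply_ne (by omega)]
    · refine hdist.mono fun k hk => ?_
      simp only [coe_Icc, Set.mem_Icc] at hk ⊢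
      omega
    · intro k hk
      rw [mem_Icc] at hk
      exact hne k (mem_Icc.mpr (by omega))
    · rw [Nat.card_Icc]
      omega
end

section
/- Let a_1, …, a_N be pairwise distinct nonzero real numbers and let k ≥ 1 be an integer. Then ∑_{N ≥ n_1 ≥ n_2 ≥ ⋯ ≥ n_k ≥ 1} a_{n_1} a_{n_2} ⋯ a_{n_k} = ∑_{j=1}^{N} ( ∏_{m=1, m≠j}^{N} (1 − a_m/a_j)^{-1} ) · a_j^{k}. -/
open Finset

theorem nestedS_replicate_succ_succ (a : ℕ → ℝ) (k N : ℕ) :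
    nestedS (List.replicate (k + 1) a) (N + 1) 1 =
      nestedS (List.replicate (k + 1) a) N 1 +
        a (N + 1) * nestedS (List.replicate k a) (N + 1) 1 := by
  simp only [List.replicate_succ, nestedS]
  rw [Finset.sum_Icc_succ_top (by omega)]

/-- The Lagrange basis polynomials on the nodes `(a j)⁻¹`, evaluated at `0`, sum to `1`. -/
theorem sum_prod_inv_one_sub_div {ι F : Type*} [DecidableEq ι] [Field F] {s : Finset ι} {a : ι → F}
    (hs : s.Nonempty) (hdist : Set.InjOn a s) (hne : ∀ i ∈ s, a i ≠ 0) :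
    ∑ j ∈ s, ∏ m ∈ s.erase j, (1 - a m / a j)⁻¹ = 1 := by
  have hinj : Set.InjOn (fun i => (a i)⁻¹) s :=
    fun i hi j hj h => hdist hi hj (inv_injective h)
  have h := congrArg (Polynomial.eval 0) (Lagrange.sum_basis hinj hs)
  rw [Polynomial.eval_finsetSum, Polynomial.eval_one] at h
  refine Eq.trans ?_ h
  refine Finset.sum_congr rfl fun j hj => ?_
  rw [Lagrange.basis, Polynomial.eval_prod]
  refine Finset.prod_congr rfl fun m hm => ?_
  obtain ⟨hmj, hm⟩ := Finset.mem_erase.mp hm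
  have hj0 := hne j hj
  have hm0 := hne m hm
  have h1 : a j - a m ≠ 0 := sub_ne_zero.mpr fun e => hmj (hdist hm hj e.symm)
  have h2 : a m - a j ≠ 0 := sub_ne_zero.mpr fun e => hmj (hdist hm hj e)
  simp only [Lagrange.basisDivisor, Polynomial.eval_mul, Polynomial.eval_C, Polynomial.eval_sub,
    Polynomial.eval_X]
  rw [one_sub_div hj0, inv_sub_inv hj0 hm0, inv_div, inv_div]
  field_simp
  ring

theorem sum_insert_prod_inv_one_sub_div_mul_pow_succ {ι F : Type*} [DecidableEq ι] [Field F]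
    {s : Finset ι} {a : ι → F} {i : ι} (hi : i ∉ s) (hdist : Set.InjOn a (insert i s : Finset ι))
    (hne : ∀ j ∈ s, a j ≠ 0) (k : ℕ) :
    ∑ j ∈ insert i s, (∏ m ∈ (insert i s).erase j, (1 - a m / a j)⁻¹) * a j ^ (k + 1) =
      ∑ j ∈ s, (∏ m ∈ s.erase j, (1 - a m / a j)⁻¹) * a j ^ (k + 1) +
        a i * ∑ j ∈ insert i s, (∏ m ∈ (insert i s).erase j, (1 - a m / a j)⁻¹) * a j ^ k := by
  rw [← sub_eq_iff_eq_add, Finset.mul_sum, ← Finset.sum_sub_distrib, Finset.sum_insert hi,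
    show ∀ x : F, x * a i ^ (k + 1) - a i * (x * a i ^ k) = 0 from fun x => by ring, zero_add]
  refine Finset.sum_congr rfl fun j hj => ?_
  have hij : i ≠ j := fun e => hi (e ▸ hj)
  have hj0 := hne j hj
  have hsub : a j - a i ≠ 0 := sub_ne_zero.mpr fun e =>
    hij (hdist (Finset.mem_insert_self i s) (Finset.mem_insert_of_mem hj) e.symm)
  rw [Finset.erase_insert_of_ne hij, Finset.prod_insert (by simp [hi]), one_sub_div hj0, inv_div]
  field_simp
  ring

theorem stmt_16 (N : ℕ) (a : ℕ → ℝ)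
    (hdist : Set.InjOn a (Set.Icc 1 N)) (hne : ∀ n ∈ Finset.Icc 1 N, a n ≠ 0)
    (k : ℕ) (hk : 1 ≤ k) :
    nestedS (List.replicate k a) N 1
      = ∑ j ∈ Finset.Icc 1 N,
          (∏ m ∈ (Finset.Icc 1 N).erase j, (1 - a m / a j)⁻¹) * a j ^ k := by
  induction N generalizing k with
  | zero =>
    obtain ⟨k, rfl⟩ := Nat.exists_eq_add_of_le' hk
    simp [List.replicate_succ, nestedS]
  | succ N ihN =>
    have hIcc : Finset.Icc 1 (N + 1) = insert (N + 1) (Finset.Icc 1 N) :=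
      (Finset.insert_Icc_right_eq_Icc_add_one (by omega)).symm
    have hdist' : Set.InjOn a (Finset.Icc 1 (N + 1)) := by rwa [Finset.coe_Icc]
    have ih := ihN (hdist.mono (Set.Icc_subset_Icc_right N.le_succ))
      (fun n hn => hne n (Finset.Icc_subset_Icc_right N.le_succ hn))
    clear hk
    induction k with
    | zero =>
      simpa [nestedS] using
        (sum_prod_inv_one_sub_div (Finset.nonempty_Icc.mpr (by omega)) hdist' hne).symm
    | succ k ihk =>
      rw [nestedS_replicate_succ_succ, ihk, ih (k + 1) (by omega)]
      rw [hIcc] at hdist' hne ⊢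
      exact (sum_insert_prod_inv_one_sub_div_mul_pow_succ (by simp) hdist'
        (fun j hj => hne j (Finset.mem_insert_of_mem hj)) k).symm
end

section
/- Let a > 0 be a real number and let N ≥ 1, k ≥ 1 be integers. Then the harmonic sum with all indices equal to a satisfies S_{a,…,a}(N) := ∑_{N ≥ n_1 ≥ n_2 ≥ ⋯ ≥ n_k ≥ 1} 1/(n_1^a n_2^a ⋯ n_k^a) = ∑_{l=1}^{N} ( ∏_{n=1, n≠l}^{N} n^a/(n^a − l^a) ) · 1/l^{ak}. -/
open Finset

/-- The Lagrange basis polynomials sum to one; evaluate that identity at `0`. -/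
theorem sum_prod_erase_div_sub_eq_one {ι K : Type*} [DecidableEq ι] [Field K] {s : Finset ι}
    {v : ι → K} (hv : Set.InjOn v s) (hs : s.Nonempty) :
    ∑ l ∈ s, ∏ n ∈ s.erase l, v n / (v n - v l) = 1 := by
  have h := congrArg (Polynomial.eval 0) (Lagrange.sum_basis hv hs)
  rw [Polynomial.eval_finsetSum, Polynomial.eval_one] at h
  rw [← h]
  refine sum_congr rfl fun l _ => ?_
  rw [Lagrange.basis, Polynomial.eval_prod]
  refine prod_congr rfl fun n _ => ?_
  rw [Lagrange.basisDivisor]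
  simp only [Polynomial.eval_mul, Polynomial.eval_C, Polynomial.eval_sub, Polynomial.eval_X]
  rw [← neg_sub (v n) (v l), inv_neg]
  ring

theorem sum_prod_erase_insert_mul_inv_pow {ι K : Type*} [DecidableEq ι] [Field K] {s : Finset ι}
    {v : ι → K} {m : ι} (hm : m ∉ s) (hv : Set.InjOn v (insert m s : Finset ι))
    (h0 : ∀ i ∈ insert m s, v i ≠ 0) (k : ℕ) :
    ∑ l ∈ insert m s, (∏ n ∈ (insert m s).erase l, v n / (v n - v l)) * (v l)⁻¹ ^ (k + 1)
      = ∑ l ∈ s, (∏ n ∈ s.erase l, v n / (v n - v l)) * (v l)⁻¹ ^ (k + 1)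
        + (v m)⁻¹ * ∑ l ∈ insert m s,
            (∏ n ∈ (insert m s).erase l, v n / (v n - v l)) * (v l)⁻¹ ^ k := by
  rw [sum_insert hm, sum_insert hm, mul_add, mul_sum, add_left_comm, ← sum_add_distrib]
  congr 1
  · ring
  refine sum_congr rfl fun l hl => ?_
  have hlm : m ≠ l := fun h => hm (h ▸ hl)
  have hsub : v m - v l ≠ 0 := sub_ne_zero.2 fun h =>
    hlm (hv (mem_insert_self m s) (mem_insert_of_mem hl) h)
  have hvm := h0 m (mem_insert_self m s)
  have hvl := h0 l (mem_insert_of_mem hl)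
  rw [erase_insert_of_ne hlm, prod_insert fun h => hm (mem_of_mem_erase h), pow_succ]
  field_simp
  ring

theorem nestedS_replicate_inv {v : ℕ → ℝ} (hv : Set.InjOn v (Set.Ici 1))
    (h0 : ∀ n, 1 ≤ n → v n ≠ 0) (k : ℕ) {N : ℕ} (hN : 1 ≤ N) :
    nestedS (List.replicate k fun n => (v n)⁻¹) N 1
      = ∑ l ∈ Icc 1 N, (∏ n ∈ (Icc 1 N).erase l, v n / (v n - v l)) * (v l)⁻¹ ^ k := by
  have hinj (M : ℕ) : Set.InjOn v (Icc 1 M : Finset ℕ) :=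
    hv.mono fun n hn => (mem_Icc.1 hn).1
  induction k generalizing N with
  | zero =>
    simpa [nestedS] using
      (sum_prod_erase_div_sub_eq_one (hinj N) (nonempty_Icc.2 hN)).symm
  | succ k ih =>
    rw [List.replicate_succ, nestedS]
    clear hN
    induction N with
    | zero => simp
    | succ N ihN =>
      have hins : insert (N + 1) (Icc 1 N) = Icc 1 (N + 1) :=
        insert_Icc_right_eq_Icc_add_one (by omega)
      have hrec := sum_prod_erase_insert_mul_inv_pow (v := v) (m := N + 1) (s := Icc 1 N)
        (by simp) (hins ▸ hinj (N + 1))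
        (fun i hi => h0 i (mem_Icc.1 (hins ▸ hi)).1) k
      rw [hins] at hrec
      rw [sum_Icc_succ_top (by omega), ihN, ih (by omega), hrec]

theorem stmt_17 (a : ℝ) (ha : 0 < a) (N k : ℕ) (hN : 1 ≤ N) (hk : 1 ≤ k) :
    nestedS (List.replicate k (fun n : ℕ => 1 / (n : ℝ) ^ a)) N 1
      = ∑ l ∈ Finset.Icc 1 N,
          (∏ n ∈ (Finset.Icc 1 N).erase l, (n : ℝ) ^ a / ((n : ℝ) ^ a - (l : ℝ) ^ a))
            * (1 / (l : ℝ) ^ (a * (k : ℝ))) := by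
  have hinj : Set.InjOn (fun n : ℕ => (n : ℝ) ^ a) (Set.Ici 1) := fun m _ n _ h =>
    Nat.cast_injective ((Real.rpow_left_inj (Nat.cast_nonneg m) (Nat.cast_nonneg n) ha.ne').1 h)
  have h0 (n : ℕ) (hn : 1 ≤ n) : (n : ℝ) ^ a ≠ 0 :=
    (Real.rpow_pos_of_pos (Nat.cast_pos.2 hn) a).ne'
  simp only [one_div]
  rw [nestedS_replicate_inv hinj h0 k hN]
  refine sum_congr rfl fun l _ => ?_
  rw [Real.rpow_mul (Nat.cast_nonneg l), Real.rpow_natCast, inv_pow]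
end

section
/- Let N ≥ 1 and k ≥ 1 be integers. Then ∑_{N ≥ n_1 ≥ n_2 ≥ ⋯ ≥ n_k ≥ 1} 1/(n_1 n_2 ⋯ n_k) = ∑_{l=1}^{N} binom(N, l) · (−1)^{l−1} / l^{k}, where binom(N, l) is the binomial coefficient. -/
open Finset

/-- The alternating binomial sum `∑ l ∈ [1, N], C(N, l) (-1) ^ (l - 1) / l ^ k`, indexed from `0`. -/
noncomputable def altBinomSum (N k : ℕ) : ℝ :=
  ∑ i ∈ Finset.range N, (N.choose (i + 1) : ℝ) * (-1) ^ i / ((i : ℝ) + 1) ^ k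

theorem altBinomSum_zero_right {N : ℕ} (hN : 1 ≤ N) : altBinomSum N 0 = 1 := by
  have h : ∑ m ∈ Finset.range (N + 1), (-1 : ℝ) ^ m * N.choose m = 0 := by
    exact_mod_cast Int.alternating_sum_range_choose_of_ne (n := N) (by omega)
  rw [Finset.sum_range_succ'] at h
  have h' : altBinomSum N 0 =
      -∑ i ∈ Finset.range N, (-1 : ℝ) ^ (i + 1) * N.choose (i + 1) := by
    rw [altBinomSum, ← Finset.sum_neg_distrib]
    refine Finset.sum_congr rfl fun i _ => ?_
    ring
  rw [h']
  simp only [pow_zero, Nat.choose_zero_right, Nat.cast_one, mul_one] at h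
  linarith

theorem altBinomSum_succ_succ (N k : ℕ) :
    altBinomSum (N + 1) (k + 1) =
      altBinomSum N (k + 1) + 1 / ((N + 1 : ℕ) : ℝ) * altBinomSum (N + 1) k := by
  have h : altBinomSum N (k + 1) = ∑ i ∈ Finset.range (N + 1),
      (N.choose (i + 1) : ℝ) * (-1) ^ i / ((i : ℝ) + 1) ^ (k + 1) := by
    simp [altBinomSum, Finset.sum_range_succ]
  rw [h, altBinomSum, altBinomSum, Finset.mul_sum, ← Finset.sum_add_distrib]
  refine Finset.sum_congr rfl fun i _ => ?_
  have hc : ((N : ℝ) + 1) * N.choose i = (N + 1).choose (i + 1) * ((i : ℝ) + 1) := by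
    exact_mod_cast Nat.add_one_mul_choose_eq N i
  have hp : ((N + 1).choose (i + 1) : ℝ) = N.choose i + N.choose (i + 1) := by
    exact_mod_cast Nat.choose_succ_succ N i
  have hi : (i : ℝ) + 1 ≠ 0 := by positivity
  have hN : (N : ℝ) + 1 ≠ 0 := by positivity
  push_cast
  field_simp
  linear_combination ((i : ℝ) + 1) ^ k * (((N : ℝ) + 1) * hp + hc)

theorem nestedS_replicate_succ_eq_altBinomSum (k N : ℕ) :
    nestedS (List.replicate (k + 1) (fun n : ℕ => 1 / (n : ℝ))) N 1 = altBinomSum N (k + 1) := by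
  have key : ∀ n, 1 ≤ n →
      nestedS (List.replicate k (fun n : ℕ => 1 / (n : ℝ))) n 1 = altBinomSum n k := by
    intro n hn
    cases k with
    | zero => simp [nestedS, altBinomSum_zero_right hn]
    | succ k => exact nestedS_replicate_succ_eq_altBinomSum k n
  rw [List.replicate_succ, nestedS]
  induction N with
  | zero => simp [altBinomSum]
  | succ N ih =>
    rw [Finset.sum_Icc_succ_top (by omega), ih, key _ (by omega), altBinomSum_succ_succ]
termination_by k

theorem stmt_18 (N k : ℕ) (hN : 1 ≤ N) (hk : 1 ≤ k) :
    nestedS (List.replicate k (fun n : ℕ => 1 / (n : ℝ))) N 1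
      = ∑ l ∈ Finset.Icc 1 N, (N.choose l : ℝ) * (-1) ^ (l - 1) / (l : ℝ) ^ k := by
  obtain ⟨k, rfl⟩ := Nat.exists_eq_add_of_le' hk
  rw [nestedS_replicate_succ_eq_altBinomSum, altBinomSum,
    ← Finset.Ico_add_one_right_eq_Icc, Finset.sum_Ico_eq_sum_range]
  simp [add_comm]
end
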